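/- Suppose 1, θ₁, …, θₙ are linearly independent over ℚ and ω < ∞. Then ω/ω̂ ≥ max( B(ω,λ), G_lin(ω̂) ), where B(ω,λ) = (1 + λ)/(1 + ω^{−1}). -/

import Mathlib

open scoped ENNReal


/-- Solvability of the simultaneous approximation system
`max_{1≤i≤n} |x₀θᵢ - xᵢ| ≤ t^{-γ}`, `0 < |x₀| ≤ t` in integers. -/
def SimSolvable (n : ℕ) (θ : Fin n → ℝ) (γ t : ℝ) : Prop :=
  ∃ x : Fin (n+1) → ℤ, x 0 ≠ 0 ∧ (|x 0| : ℝ) ≤ t ∧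
    ∀ i : Fin n, |(x 0 : ℝ) * θ i - (x i.succ : ℝ)| ≤ t ^ (-γ)

/-- Solvability of the linear form system
`|x₀ + θ₁x₁ + … + θₙxₙ| ≤ t^{-γ}`, `0 < max_{1≤i≤n} |xᵢ| ≤ t` in integers. -/
def LinSolvable (n : ℕ) (θ : Fin n → ℝ) (γ t : ℝ) : Prop :=
  ∃ x : Fin (n+1) → ℤ, (∃ i : Fin n, x i.succ ≠ 0) ∧ (∀ i : Fin n, (|x i.succ| : ℝ) ≤ t) ∧
    |(x 0 : ℝ) + ∑ i : Fin n, θ i * (x i.succ : ℝ)| ≤ t ^ (-γ)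

/-- The regular simultaneous Diophantine exponent `λ(θ) ∈ [0,∞]`. -/
noncomputable def lambdaExp (n : ℕ) (θ : Fin n → ℝ) : ℝ≥0∞ :=
  sSup {e : ℝ≥0∞ | ∃ γ : ℝ, 0 < γ ∧ e = ENNReal.ofReal γ ∧
    ∀ T : ℝ, ∃ t : ℝ, T < t ∧ SimSolvable n θ γ t}

/-- The uniform simultaneous Diophantine exponent `λ̂(θ) ∈ [0,∞]`. -/
noncomputable def lambdaHatExp (n : ℕ) (θ : Fin n → ℝ) : ℝ≥0∞ :=
  sSup {e : ℝ≥0∞ | ∃ γ : ℝ, 0 < γ ∧ e = ENNReal.ofReal γ ∧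
    ∃ T : ℝ, ∀ t : ℝ, T < t → SimSolvable n θ γ t}

/-- The regular linear form Diophantine exponent `ω(θ) ∈ [0,∞]`. -/
noncomputable def omegaExp (n : ℕ) (θ : Fin n → ℝ) : ℝ≥0∞ :=
  sSup {e : ℝ≥0∞ | ∃ γ : ℝ, 0 < γ ∧ e = ENNReal.ofReal γ ∧
    ∀ T : ℝ, ∃ t : ℝ, T < t ∧ LinSolvable n θ γ t}

/-- The uniform linear form Diophantine exponent `ω̂(θ) ∈ [0,∞]`. -/
noncomputable def omegaHatExp (n : ℕ) (θ : Fin n → ℝ) : ℝ≥0∞ :=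
  sSup {e : ℝ≥0∞ | ∃ γ : ℝ, 0 < γ ∧ e = ENNReal.ofReal γ ∧
    ∃ T : ℝ, ∀ t : ℝ, T < t → LinSolvable n θ γ t}
/-- `G_lin(w)`: the largest real root of `f(x) = w⁻¹xⁿ - x + (1 - w⁻¹)`
(the root set always contains `1`, so the supremum is the largest root). -/
noncomputable def Glin (n : ℕ) (w : ℝ) : ℝ :=
  sSup {x : ℝ | w⁻¹ * x ^ n - x + (1 - w⁻¹) = 0}

/-- The span of the consecutive vectors `y i, …, y b`. -/
def segSpan {E : Type*} [AddCommGroup E] [Module ℝ E] (y : ℕ → E) (i b : ℕ) : Submodule ℝ E :=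
  Submodule.span ℝ (y '' Set.Icc i b)

section SegSpan

variable {E : Type*} [AddCommGroup E] [Module ℝ E] {y : ℕ → E}

lemma mem_segSpan {i j b : ℕ} (hij : i ≤ j) (hjb : j ≤ b) : y j ∈ segSpan y i b :=
  Submodule.subset_span ⟨j, ⟨hij, hjb⟩, rfl⟩

lemma segSpan_mono {i i' b b' : ℕ} (hi : i' ≤ i) (hb : b ≤ b') :
    segSpan y i b ≤ segSpan y i' b' :=
  Submodule.span_mono (Set.image_mono (Set.Icc_subset_Icc hi hb))

lemma segSpan_succ_right {i b : ℕ} (h : i ≤ b + 1) :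
    segSpan y i (b + 1) = segSpan y i b ⊔ Submodule.span ℝ {y (b + 1)} := by
  have : Set.Icc i (b + 1) = Set.Icc i b ∪ {b + 1} := by
    ext j; simp only [Set.mem_Icc, Set.mem_union, Set.mem_singleton_iff]; omega
  rw [segSpan, this, Set.image_union, Submodule.span_union, Set.image_singleton, segSpan]

lemma segSpan_succ_left {i b : ℕ} (h : i ≤ b) :
    segSpan y i b = segSpan y (i + 1) b ⊔ Submodule.span ℝ {y i} := by
  have : Set.Icc i b = Set.Icc (i + 1) b ∪ {i} := by
    ext j; simp only [Set.mem_Icc, Set.mem_union, Set.mem_singleton_iff]; omega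
  rw [segSpan, this, Set.image_union, Submodule.span_union, Set.image_singleton, segSpan]

lemma segSpan_self (i : ℕ) : segSpan y i i = Submodule.span ℝ {y i} := by
  simp [segSpan]

variable [FiniteDimensional ℝ E]

lemma finrank_sup_span_singleton_le (U : Submodule ℝ E) (v : E) :
    Module.finrank ℝ ↥(U ⊔ Submodule.span ℝ {v}) ≤ Module.finrank ℝ U + 1 := by
  have h1 := Submodule.finrank_add_le_finrank_add_finrank U (Submodule.span ℝ {v})
  have h2 : Module.finrank ℝ ↥(Submodule.span ℝ {v}) ≤ 1 := by
    simpa using finrank_span_le_card (R := ℝ) ({v} : Set E)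
  omega

lemma finrank_sup_span_singleton_of_notMem {U : Submodule ℝ E} {v : E} (hv : v ∉ U) :
    Module.finrank ℝ ↥(U ⊔ Submodule.span ℝ {v}) = Module.finrank ℝ U + 1 := by
  refine le_antisymm (finrank_sup_span_singleton_le U v) ?_
  refine Submodule.finrank_lt_finrank_of_lt (lt_of_le_of_ne le_sup_left fun h => hv ?_)
  rw [h]
  exact Submodule.mem_sup_right (Submodule.mem_span_singleton_self v)

/-- Growing a segment to the right until its span reaches dimension `k + 2`. -/
lemma exists_right_cut {k i b : ℕ} (hib : i ≤ b)
    (hd : Module.finrank ℝ (segSpan y i b) = k + 2) :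
    ∃ c, i ≤ c ∧ Module.finrank ℝ (segSpan y i c) = k + 1 ∧ y (c + 1) ∉ segSpan y i c ∧
      segSpan y i b = segSpan y i c ⊔ Submodule.span ℝ {y (c + 1)} := by
  classical
  have hex : ∃ m, i ≤ m ∧ k + 2 ≤ Module.finrank ℝ (segSpan y i m) := ⟨b, hib, hd.ge⟩
  obtain ⟨him, hm⟩ := Nat.find_spec hex
  have hmb : Nat.find hex ≤ b := Nat.find_min' hex ⟨hib, hd.ge⟩
  have hne : Nat.find hex ≠ i := by
    intro h
    rw [h, segSpan_self] at hm
    have : Module.finrank ℝ ↥(Submodule.span ℝ {y i}) ≤ 1 := by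
      simpa using finrank_span_le_card (R := ℝ) ({y i} : Set E)
    omega
  obtain ⟨c, hc⟩ : ∃ c, Nat.find hex = c + 1 := ⟨Nat.find hex - 1, by omega⟩
  have hic : i ≤ c := by omega
  have hlt : Module.finrank ℝ (segSpan y i c) < k + 2 := by
    by_contra hcon
    exact Nat.find_min hex (show c < Nat.find hex by omega) ⟨hic, by omega⟩
  rw [hc, segSpan_succ_right (by omega)] at hm
  have h1 := finrank_sup_span_singleton_le (segSpan y i c) (y (c + 1))
  refine ⟨c, hic, by omega, fun hmem => ?_, ?_⟩
  · have : segSpan y i c ⊔ Submodule.span ℝ {y (c + 1)} = segSpan y i c :=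
      sup_eq_left.2 ((Submodule.span_singleton_le_iff_mem _ _).2 hmem)
    rw [this] at hm
    omega
  · symm
    rw [← segSpan_succ_right (by omega)]
    refine Submodule.eq_of_le_of_finrank_le (segSpan_mono le_rfl (by omega)) ?_
    rw [segSpan_succ_right (by omega)]
    omega

/-- Shrinking a segment from the left as far as its span keeps dimension `k + 2`. -/
lemma exists_left_cut {k i b : ℕ} (hib : i ≤ b)
    (hd : Module.finrank ℝ (segSpan y i b) = k + 2) :
    ∃ q, i ≤ q ∧ q + 1 ≤ b ∧ Module.finrank ℝ (segSpan y (q + 1) b) = k + 1 ∧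
      y q ∉ segSpan y (q + 1) b ∧
      segSpan y i b = segSpan y (q + 1) b ⊔ Submodule.span ℝ {y q} := by
  classical
  let P : ℕ → Prop := fun q => k + 2 ≤ Module.finrank ℝ (segSpan y q b)
  have hPi : P i := hd.ge
  have hself : ∀ q, b ≤ q → ¬ P q := by
    intro q hq hP
    have hle : segSpan y q b ≤ Submodule.span ℝ {y b} := by
      rw [← segSpan_self]; exact segSpan_mono hq le_rfl
    have h1 := Submodule.finrank_mono hle
    have : Module.finrank ℝ ↥(Submodule.span ℝ {y b}) ≤ 1 := by
      simpa using finrank_span_le_card (R := ℝ) ({y b} : Set E)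
    have hP' : k + 2 ≤ Module.finrank ℝ (segSpan y q b) := hP
    omega
  set q := Nat.findGreatest P b with hq
  have hPq : P q := Nat.findGreatest_spec hib hPi
  have hiq : i ≤ q := Nat.le_findGreatest hib hPi
  have hqb : q < b := by
    by_contra hcon
    exact hself q (by omega) hPq
  have hnot : ¬ P (q + 1) := Nat.findGreatest_is_greatest (Nat.lt_succ_self _) hqb
  have hPq' : k + 2 ≤ Module.finrank ℝ (segSpan y q b) := hPq
  have hnot' : ¬ k + 2 ≤ Module.finrank ℝ (segSpan y (q + 1) b) := hnot
  rw [segSpan_succ_left hqb.le] at hPq'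
  have h1 := finrank_sup_span_singleton_le (segSpan y (q + 1) b) (y q)
  refine ⟨q, hiq, hqb, by omega, fun hmem => ?_, ?_⟩
  · have : segSpan y (q + 1) b ⊔ Submodule.span ℝ {y q} = segSpan y (q + 1) b :=
      sup_eq_left.2 ((Submodule.span_singleton_le_iff_mem _ _).2 hmem)
    rw [this] at hPq'
    omega
  · symm
    rw [← segSpan_succ_left hqb.le]
    refine Submodule.eq_of_le_of_finrank_le (segSpan_mono hiq le_rfl) ?_
    rw [segSpan_succ_left hqb.le]
    omega

end SegSpan

/-- A sequence of vectors `y` with logarithmic sizes `x` and logarithmic approximation qualities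
`ℓ`, together with a logarithmic height bound `HB U a` on subspaces (`a` bounds the height of `U`),
subject to the growth conditions `w x (i + 1) ≤ ℓ i ≤ r w x i`. -/
structure HeightSystem {E : Type*} [AddCommGroup E] [Module ℝ E] (y : ℕ → E) (x ℓ : ℕ → ℝ)
    (HB : Submodule ℝ E → ℝ → Prop) (w r : ℝ) : Prop where
  w_pos : 0 < w
  one_le_r : 1 ≤ r
  mono : ∀ U a b, HB U a → a ≤ b → HB U b
  single : ∀ i, HB (Submodule.span ℝ {y i}) (-ℓ i)
  right : ∀ U b a, y b ∈ U → y (b + 1) ∉ U → HB U a →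
    HB (U ⊔ Submodule.span ℝ {y (b + 1)}) (a + x (b + 1))
  left : ∀ U i a, y (i + 1) ∈ U → y i ∉ U → HB U a →
    HB (U ⊔ Submodule.span ℝ {y i}) (a + x (i + 1) - ℓ i + ℓ (i + 1))
  bddBelow : ∀ U i, y i ∈ U → ∃ K, ∀ a, HB U a → K ≤ a
  lower : ∀ i, w * x (i + 1) ≤ ℓ i
  upper : ∀ i, ℓ i ≤ r * w * x i
  x_pos : ∀ i, 0 < x i
  x_tendsto : Filter.Tendsto x Filter.atTop Filter.atTop
  ne_zero : ∀ i, y i ≠ 0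
  notMem : ∀ i, y (i + 1) ∉ Submodule.span ℝ {y i}

namespace HeightSystem

variable {E : Type*} [AddCommGroup E] [Module ℝ E] {y : ℕ → E} {x ℓ : ℕ → ℝ}
  {HB : Submodule ℝ E → ℝ → Prop} {w r : ℝ}

lemma x_succ_le (h : HeightSystem y x ℓ HB w r) (i : ℕ) : x (i + 1) ≤ r * x i := by
  have h1 := h.lower i
  have h2 := h.upper i
  have h3 : w * x (i + 1) ≤ w * (r * x i) := by linarith
  exact le_of_mul_le_mul_left h3 h.w_pos

lemma convex (h : HeightSystem y x ℓ HB w r) {U : Submodule ℝ E} {a b t : ℝ}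
    (ha : HB U a) (hb : HB U b) (h0 : 0 ≤ t) (h1 : t ≤ 1) : HB U (t * a + (1 - t) * b) := by
  rcases le_total a b with hab | hab
  · exact h.mono _ _ _ ha (by nlinarith)
  · exact h.mono _ _ _ hb (by nlinarith)

variable [FiniteDimensional ℝ E]

lemma bound_dim_one (h : HeightSystem y x ℓ HB w r) {i b : ℕ} (hib : i ≤ b)
    (hd : Module.finrank ℝ (segSpan y i b) = 1) : HB (segSpan y i b) (-ℓ i) := by
  have hle : Submodule.span ℝ {y i} ≤ segSpan y i b :=
    (Submodule.span_singleton_le_iff_mem _ _).2 (mem_segSpan le_rfl hib)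
  rw [← Submodule.eq_of_le_of_finrank_le hle (by rw [hd, finrank_span_singleton (h.ne_zero i)])]
  exact h.single i

lemma bound_dim_two (h : HeightSystem y x ℓ HB w r) {i b : ℕ} (hib : i ≤ b)
    (hd : Module.finrank ℝ (segSpan y i b) = 2) :
    HB (segSpan y i b) (-(w - 1) * x b) ∧ HB (segSpan y i b) (-ℓ i + r * x i) := by
  have hlt : i < b := by
    rcases hib.lt_or_eq with h' | rfl
    · exact h'
    · rw [segSpan_self, finrank_span_singleton (h.ne_zero i)] at hd
      omega
  have key : ∀ j, i ≤ j → j + 1 ≤ b →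
      HB (segSpan y i b) (-ℓ j + x (j + 1)) := by
    intro j hj hjb
    have hle : Submodule.span ℝ {y j} ⊔ Submodule.span ℝ {y (j + 1)} ≤ segSpan y i b :=
      sup_le ((Submodule.span_singleton_le_iff_mem _ _).2 (mem_segSpan hj (by omega)))
        ((Submodule.span_singleton_le_iff_mem _ _).2 (mem_segSpan (by omega) hjb))
    rw [← Submodule.eq_of_le_of_finrank_le hle (by
      rw [hd, finrank_sup_span_singleton_of_notMem (h.notMem j),
        finrank_span_singleton (h.ne_zero j)])]
    exact h.right _ _ _ (Submodule.mem_span_singleton_self _) (h.notMem j) (h.single j)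
  constructor
  · obtain ⟨c, rfl⟩ : ∃ c, b = c + 1 := ⟨b - 1, by omega⟩
    refine h.mono _ _ _ (key c (by omega) le_rfl) ?_
    linarith [h.lower c]
  · refine h.mono _ _ _ (key i le_rfl hlt) ?_
    linarith [h.x_succ_le i]

lemma bound_segSpan (h : HeightSystem y x ℓ HB w r) (k : ℕ)
    (hk : ∑ j ∈ Finset.range (k + 1), r ^ j < w) (i b : ℕ) (hib : i ≤ b)
    (hd : Module.finrank ℝ (segSpan y i b) = k + 2) (hb : y (b + 1) ∉ segSpan y i b) :
    HB (segSpan y i b) (-((w - ∑ j ∈ Finset.range (k + 1), r ^ j) / r ^ k) * x b) ∧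
      HB (segSpan y i b) (-ℓ i + r * (∑ j ∈ Finset.range (k + 1), r ^ j) * x i) := by
  induction k generalizing i b with
  | zero => simpa using h.bound_dim_two hib hd
  | succ k ih =>
    have hr := h.one_le_r
    have hr0 : 0 < r := by linarith
    set s := ∑ j ∈ Finset.range (k + 1), r ^ j with hs
    have hs1 : ∑ j ∈ Finset.range (k + 1 + 1), r ^ j = s + r * r ^ k := by
      rw [Finset.sum_range_succ, pow_succ']
    have hs2 : ∑ j ∈ Finset.range (k + 1 + 1), r ^ j = r * s + 1 := geom_sum_succ
    have hp : 0 < r ^ k := pow_pos hr0 k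
    have hrp : 0 < r * r ^ k := by positivity
    have hsw : s < w := by linarith
    have hws : 0 < w - s := by linarith
    specialize ih hsw
    constructor
    · obtain ⟨q, hiq, hqb, hdq, hyq, heq⟩ := exists_left_cut hib hd
      have hbq : y (b + 1) ∉ segSpan y (q + 1) b := fun hm =>
        hb (segSpan_mono (by omega) le_rfl hm)
      obtain ⟨hA, hB⟩ := ih (q + 1) b hqb hdq hbq
      rw [hs2] at hk ⊢
      set t := (w - (r * s + 1)) / (r * (w - s)) with ht
      have ht0 : 0 ≤ t := div_nonneg (by linarith) (by positivity)
      have ht1 : t ≤ 1 := by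
        rw [ht, div_le_one (by positivity)]
        nlinarith
      have htm : t * (r * (w - s)) = w - (r * s + 1) := by
        rw [ht]; field_simp
      have := h.left _ _ _ (mem_segSpan le_rfl hqb) hyq (h.convex hA hB ht0 ht1)
      rw [heq]
      refine h.mono _ _ _ this ?_
      have e1 : t * (-((w - s) / r ^ k) * x b) = -((w - (r * s + 1)) / r ^ (k + 1)) * x b := by
        rw [ht, pow_succ']; field_simp
      rw [e1]
      have h1 := h.lower q
      have h2 := mul_le_mul_of_nonneg_left (h.upper (q + 1)) ht0
      have h3 : t * (r * w * x (q + 1)) + (1 - t) * (r * s * x (q + 1)) + x (q + 1)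
          - w * x (q + 1) = 0 := by
        linear_combination htm * x (q + 1)
      linarith
    · obtain ⟨c, hic, hdc, hyc, heq⟩ := exists_right_cut hib hd
      obtain ⟨hA, hB⟩ := ih i c hic hdc hyc
      rw [hs1] at hk ⊢
      set t := (r * r ^ k) / (w - s) with ht
      have ht0 : 0 ≤ t := by positivity
      have ht1 : t ≤ 1 := by
        rw [ht, div_le_one hws]; linarith
      have htm : t * (w - s) = r * r ^ k := by
        rw [ht]; field_simp
      have := h.right _ _ _ (mem_segSpan hic le_rfl) hyc (h.convex hA hB ht0 ht1)
      rw [heq]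
      refine h.mono _ _ _ this ?_
      have e1 : t * (-((w - s) / r ^ k) * x c) = - (r * x c) := by
        rw [ht]; field_simp
      rw [e1]
      have h1 := h.x_succ_le c
      have h2 := mul_le_mul_of_nonneg_left (h.upper i) ht0
      have h3 : t * (r * w * x i) - t * (r * s * x i) = r * (r * r ^ k) * x i := by
        linear_combination htm * r * x i
      linarith

/-- In a height system of dimension `n + 1` one has `w ≤ 1 + r + ⋯ + r ^ (n - 1)`. -/
theorem le_geom_sum (h : HeightSystem y x ℓ HB w r) {n : ℕ} (hn : Module.finrank ℝ E = n + 1) :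
    w ≤ ∑ j ∈ Finset.range n, r ^ j := by
  by_contra! hcon
  have hr0 : 0 ≤ r := zero_le_one.trans h.one_le_r
  let V : ℕ → Submodule ℝ E := fun q => Submodule.span ℝ (y '' Set.Ici q)
  have hVanti : ∀ p q, p ≤ q → V q ≤ V p := fun p q hpq =>
    Submodule.span_mono (Set.image_mono (Set.Ici_subset_Ici.2 hpq))
  have hVmem : ∀ p q, p ≤ q → y q ∈ V p := fun p q hpq => Submodule.subset_span ⟨q, hpq, rfl⟩
  obtain ⟨p, hp⟩ : ∃ p, ∀ q, Module.finrank ℝ (V p) ≤ Module.finrank ℝ (V q) :=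
    ⟨Function.argmin (fun q => Module.finrank ℝ (V q)), fun q =>
      Function.argmin_le (fun q => Module.finrank ℝ (V q)) q⟩
  have hVeq : ∀ q, p ≤ q → V q = V p := fun q hq =>
    Submodule.eq_of_le_of_finrank_le (hVanti p q hq) (hp q)
  obtain ⟨K, hK⟩ := h.bddBelow (V p) p (hVmem p p le_rfl)
  obtain ⟨N, hN⟩ := Filter.eventually_atTop.1 (h.x_tendsto.eventually_gt_atTop
    (-K / (w - ∑ j ∈ Finset.range n, r ^ j)))
  set q₀ := max p N with hq₀
  have hsub : ∀ i b, q₀ ≤ i → segSpan y i b ≤ V p := fun i b hi =>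
    Submodule.span_le.2 (by
      rintro _ ⟨j, hj, rfl⟩
      exact hVmem p j (by have := hj.1; omega))
  obtain ⟨b₀, hb₀, hVb⟩ : ∃ b₀, q₀ ≤ b₀ ∧ segSpan y q₀ b₀ = V p := by
    obtain ⟨b, hb⟩ : ∃ b, ∀ c, Module.finrank ℝ (segSpan y q₀ c) ≤
        Module.finrank ℝ (segSpan y q₀ b) := by
      have hbdd : ∀ c, Module.finrank ℝ (segSpan y q₀ c) ≤ n + 1 := fun c =>
        hn ▸ Submodule.finrank_le _
      refine ⟨Function.argmin (fun c => n + 1 - Module.finrank ℝ (segSpan y q₀ c)), fun c => ?_⟩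
      have h1 := Function.argmin_le (fun c => n + 1 - Module.finrank ℝ (segSpan y q₀ c)) c
      have h2 := hbdd c
      omega
    have hmax : ∀ c, b ≤ c → segSpan y q₀ b = segSpan y q₀ c := fun c hc =>
      Submodule.eq_of_le_of_finrank_le (segSpan_mono le_rfl hc) (hb c)
    refine ⟨max b q₀, le_max_right _ _, le_antisymm (hsub _ _ le_rfl) ?_⟩
    rw [← hVeq q₀ (le_max_left _ _)]
    refine Submodule.span_le.2 ?_
    rintro _ ⟨j, hj, rfl⟩
    rw [← hmax _ (le_max_left _ _), hmax (max b j) (le_max_left _ _)]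
    exact mem_segSpan hj (le_max_right _ _)
  obtain ⟨k, hk⟩ : ∃ k, Module.finrank ℝ (V p) = k + 2 := by
    have hle : Submodule.span ℝ {y p} ⊔ Submodule.span ℝ {y (p + 1)} ≤ V p :=
      sup_le ((Submodule.span_singleton_le_iff_mem _ _).2 (hVmem p p le_rfl))
        ((Submodule.span_singleton_le_iff_mem _ _).2 (hVmem p _ (Nat.le_succ p)))
    have := Submodule.finrank_mono hle
    rw [finrank_sup_span_singleton_of_notMem (h.notMem p),
      finrank_span_singleton (h.ne_zero p)] at this
    exact ⟨Module.finrank ℝ (V p) - 2, by omega⟩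
  have hkn : k + 1 ≤ n := by
    have := Submodule.finrank_le (V p)
    omega
  obtain ⟨q, hq, hqb, hdq, hyq, heq⟩ := exists_left_cut hb₀ (hVb ▸ hk)
  rw [hVb] at heq
  obtain ⟨b, hbb, hsb, hyb⟩ : ∃ b, b₀ ≤ b ∧ segSpan y (q + 1) b = segSpan y (q + 1) b₀ ∧
      y (b + 1) ∉ segSpan y (q + 1) b := by
    classical
    have hex : ∃ m, q + 1 ≤ m ∧ y m ∉ segSpan y (q + 1) b₀ := by
      by_contra! hall
      have : V (q + 1) ≤ segSpan y (q + 1) b₀ := Submodule.span_le.2 (by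
        rintro _ ⟨j, hj, rfl⟩
        exact hall j hj)
      rw [hVeq (q + 1) (by omega)] at this
      exact hyq (this (hVmem p q (by omega)))
    obtain ⟨hm1, hm2⟩ := Nat.find_spec hex
    have hgt : b₀ < Nat.find hex := by
      by_contra! hle
      exact hm2 (mem_segSpan hm1 hle)
    obtain ⟨b, hb⟩ : ∃ b, Nat.find hex = b + 1 := ⟨Nat.find hex - 1, by omega⟩
    have hsb : segSpan y (q + 1) b = segSpan y (q + 1) b₀ := by
      refine le_antisymm (Submodule.span_le.2 ?_) (segSpan_mono le_rfl (by omega))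
      rintro _ ⟨j, hj, rfl⟩
      by_contra hcon'
      exact Nat.find_min hex (show j < Nat.find hex by have := hj.2; omega) ⟨hj.1, hcon'⟩
    refine ⟨b, by omega, hsb, ?_⟩
    rw [hsb, ← hb]
    exact hm2
  have hmonoS : ∀ m m', m ≤ m' →
      ∑ j ∈ Finset.range m, r ^ j ≤ ∑ j ∈ Finset.range m', r ^ j := fun m m' hmm =>
    Finset.sum_le_sum_of_subset_of_nonneg (Finset.range_mono hmm)
      (fun j _ _ => pow_nonneg hr0 j)
  have hE : HB (segSpan y (q + 1) b₀)
      (-ℓ (q + 1) + r * (∑ j ∈ Finset.range k, r ^ j) * x (q + 1)) := by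
    rw [← hsb]
    rw [← hsb] at hdq
    cases k with
    | zero => simpa using h.bound_dim_one (by omega) hdq
    | succ k =>
      exact (h.bound_segSpan k ((hmonoS _ _ (by omega)).trans_lt hcon) _ _ (by omega) hdq hyb).2
  have hfin := hK _ (heq ▸ h.left _ _ _ (mem_segSpan le_rfl hqb) hyq hE)
  have h1 := h.lower q
  have h2 : ∑ j ∈ Finset.range (k + 1), r ^ j = r * ∑ j ∈ Finset.range k, r ^ j + 1 :=
    geom_sum_succ
  have h3 := hmonoS _ _ hkn
  have h4 := hN (q + 1) (by omega)
  rw [div_lt_iff₀ (by linarith)] at h4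
  have h5 := mul_le_mul_of_nonneg_right h3 (h.x_pos (q + 1)).le
  rw [h2] at h5
  linarith

end HeightSystem

/-- The value `x₀ + θ₁ x₁ + ⋯ + θₙ xₙ` of the linear form at an integer point. -/
def linVal {n : ℕ} (θ : Fin n → ℝ) (x : Fin (n + 1) → ℤ) : ℝ :=
  (x 0 : ℝ) + ∑ i : Fin n, θ i * (x i.succ : ℝ)

/-- The point `x` in the coordinates `(linVal θ x, x₁, …, xₙ)`. -/
def formVec {n : ℕ} (θ : Fin n → ℝ) (x : Fin (n + 1) → ℤ) : Fin (n + 1) → ℝ :=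
  Fin.cons (linVal θ x) (fun i => (x i.succ : ℝ))

/-- `exp a` bounds the height of the subspace `U` relative to the linear form: `U` is spanned by
integer points `u₀, …, u_{d-1}`, with `d = dim U`, such that `|det (u₀, …, u_{d-1}, w_d, …, w_n)|`
is at most `exp a` for all `w_d, …, w_n` in the unit cube of the kernel of the form. -/
def FormHeightLE {n : ℕ} (θ : Fin n → ℝ) (U : Submodule ℝ (Fin (n + 1) → ℝ)) (a : ℝ) : Prop :=
  ∃ u : Fin (n + 1) → Fin (n + 1) → ℤ,
    U = Submodule.span ℝ ((fun j => formVec θ (u j)) '' {j | (j : ℕ) < Module.finrank ℝ U}) ∧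
    ∀ M : Matrix (Fin (n + 1)) (Fin (n + 1)) ℝ,
      (∀ j : Fin (n + 1), (j : ℕ) < Module.finrank ℝ U → M j = formVec θ (u j)) →
      (∀ j : Fin (n + 1), Module.finrank ℝ U ≤ (j : ℕ) → M j 0 = 0 ∧ ∀ i, |M j i| ≤ 1) →
      |M.det| ≤ Real.exp a

section FormHeight

variable {n : ℕ} {θ : Fin n → ℝ}

@[simp] lemma formVec_zero (x : Fin (n + 1) → ℤ) : formVec θ x 0 = linVal θ x := rfl

@[simp] lemma formVec_succ (x : Fin (n + 1) → ℤ) (i : Fin n) :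
    formVec θ x i.succ = (x i.succ : ℝ) := rfl

/-- The matrix changing standard coordinates into those of `formVec`. -/
def formMatrix (θ : Fin n → ℝ) : Matrix (Fin (n + 1)) (Fin (n + 1)) ℝ :=
  Matrix.of fun i j => Fin.cases ((Fin.cons 1 θ : Fin (n + 1) → ℝ) i) (fun k => if i = k.succ then 1 else 0) j

lemma formVec_eq_vecMul (x : Fin (n + 1) → ℤ) :
    formVec θ x = Matrix.vecMul (fun i => (x i : ℝ)) (formMatrix θ) := by
  ext j
  refine Fin.cases ?_ (fun k => ?_) j
  · simp [Matrix.vecMul, dotProduct, formMatrix, Fin.sum_univ_succ, linVal, mul_comm]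
  · simp [Matrix.vecMul, dotProduct, formMatrix]

lemma det_formMatrix (θ : Fin n → ℝ) : (formMatrix θ).det = 1 := by
  rw [Matrix.det_of_isLowerTriangular]
  · refine Finset.prod_eq_one fun i _ => ?_
    refine Fin.cases ?_ (fun k => ?_) i <;> simp [formMatrix]
  · intro i j hij
    have hij' : i < j := hij
    revert hij'
    refine Fin.cases (fun h => ?_) (fun k h => ?_) j
    · exact absurd h (Fin.not_lt_zero _)
    · simp [formMatrix, h.ne]

lemma FormHeightLE.mono {U : Submodule ℝ (Fin (n + 1) → ℝ)} {a b : ℝ} (h : FormHeightLE θ U a)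
    (hab : a ≤ b) : FormHeightLE θ U b := by
  obtain ⟨u, hu, hM⟩ := h
  exact ⟨u, hu, fun M h1 h2 => (hM M h1 h2).trans (Real.exp_le_exp.2 hab)⟩

lemma FormHeightLE.zero_le_of_top {a : ℝ} (h : FormHeightLE θ ⊤ a) : 0 ≤ a := by
  obtain ⟨u, hu, hM⟩ := h
  have hf : Module.finrank ℝ (⊤ : Submodule ℝ (Fin (n + 1) → ℝ)) = n + 1 := by simp
  rw [hf] at hu hM
  set M : Matrix (Fin (n + 1)) (Fin (n + 1)) ℝ := Matrix.of fun j => formVec θ (u j) with hMdef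
  have hb := hM M (fun j _ => rfl) (fun j hj => absurd j.isLt (by omega))
  have hset : {j : Fin (n + 1) | (j : ℕ) < n + 1} = Set.univ := by
    ext j; simpa using j.isLt
  rw [hset, Set.image_univ] at hu
  have hli : LinearIndependent ℝ M := linearIndependent_of_top_le_span_of_card_eq_finrank
    (le_of_eq hu) (by simp)
  have hdet : M.det ≠ 0 := by
    have := (Matrix.linearIndependent_rows_iff_isUnit (A := M)).1 hli
    exact ((Matrix.isUnit_iff_isUnit_det _).1 this).ne_zero
  have hM' : M = ((Matrix.of u).map (Int.castRingHom ℝ)) * formMatrix θ := by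
    ext i j
    rw [hMdef, Matrix.of_apply, formVec_eq_vecMul]
    rfl
  have hdi : M.det = (((Matrix.of u).det : ℤ) : ℝ) := by
    rw [hM', Matrix.det_mul, det_formMatrix, mul_one, ← RingHom.mapMatrix_apply, ← RingHom.map_det]
    rfl
  rw [hdi] at hdet hb
  have h1 : (1 : ℝ) ≤ |(((Matrix.of u).det : ℤ) : ℝ)| := by
    have : (Matrix.of u).det ≠ 0 := by exact_mod_cast hdet
    exact_mod_cast Int.one_le_abs this
  have : (1 : ℝ) ≤ Real.exp a := h1.trans hb
  exact Real.one_le_exp_iff.1 this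

lemma FormHeightLE.sup_span_singleton {U : Submodule ℝ (Fin (n + 1) → ℝ)} {a ρ : ℝ}
    {v : Fin (n + 1) → ℝ} {z : Fin (n + 1) → ℤ} (h : FormHeightLE θ U a) (hv : v ∈ U)
    (hz : formVec θ z ∉ U) (h0 : v 0 = linVal θ z) (hρ : 0 < ρ)
    (hle : ∀ i, |formVec θ z i - v i| ≤ ρ) :
    FormHeightLE θ (U ⊔ Submodule.span ℝ {formVec θ z}) (a + Real.log ρ) := by
  obtain ⟨u, hu, hM⟩ := h
  set d := Module.finrank ℝ U with hd
  have hd' : Module.finrank ℝ ↥(U ⊔ Submodule.span ℝ {formVec θ z}) = d + 1 :=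
    finrank_sup_span_singleton_of_notMem hz
  have hdn : d < n + 1 := by
    have := Submodule.finrank_le (U ⊔ Submodule.span ℝ {formVec θ z})
    rw [hd', Module.finrank_fin_fun] at this
    omega
  let e : Fin (n + 1) := ⟨d, hdn⟩
  rw [FormHeightLE, hd']
  have hupd : ∀ j : Fin (n + 1), (j : ℕ) < d → Function.update u e z j = u j := fun j hj =>
    Function.update_of_ne (by rintro rfl; exact lt_irrefl _ hj) _ _
  refine ⟨Function.update u e z, ?_, fun M h1 h2 => ?_⟩
  · have hset : {j : Fin (n + 1) | (j : ℕ) < d + 1} =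
        ({j | (j : ℕ) < d} : Set (Fin (n + 1))) ∪ {e} := by
      ext j
      simp only [Set.mem_ofPred_eq, Set.mem_union, Set.mem_singleton_iff, Fin.ext_iff, e]
      omega
    have himg : (fun j => formVec θ (Function.update u e z j)) '' {j | (j : ℕ) < d} =
        (fun j => formVec θ (u j)) '' {j | (j : ℕ) < d} :=
      Set.image_congr fun j hj => by simp only [hupd j hj]
    rw [hset, Set.image_union, Submodule.span_union, Set.image_singleton, Function.update_self,
      himg, ← hu]
  · have hrow : M e = v + ρ • (ρ⁻¹ • (formVec θ z - v)) := by
      rw [smul_smul, mul_inv_cancel₀ hρ.ne', one_smul, h1 e (Nat.lt_succ_self d),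
        Function.update_self]
      abel
    have hlow : ∀ (c : Fin (n + 1) → ℝ) (j : Fin (n + 1)), (j : ℕ) < d →
        M.updateRow e c j = formVec θ (u j) := by
      intro c j hj
      rw [Matrix.updateRow_ne (by rintro rfl; exact lt_irrefl _ hj), h1 j (by omega), hupd j hj]
    have hdet0 : (M.updateRow e v).det = 0 := by
      by_contra hne
      have hli : LinearIndependent ℝ (M.updateRow e v).row :=
        (Matrix.linearIndependent_rows_iff_isUnit (A := M.updateRow e v)).2
          ((Matrix.isUnit_iff_isUnit_det _).2 (isUnit_iff_ne_zero.2 hne))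
      have hnot := hli.notMem_span_image (s := {j | (j : ℕ) < d}) (x := e) (by simp [e])
      refine hnot ?_
      have himg : (M.updateRow e v).row '' {j | (j : ℕ) < d} =
          (fun j => formVec θ (u j)) '' {j | (j : ℕ) < d} := Set.image_congr fun j hj => hlow v j hj
      have hrow_e : (M.updateRow e v).row e = v := Matrix.updateRow_self
      rw [himg, ← hu, hrow_e]
      exact hv
    have hdet : M.det = ρ * (M.updateRow e (ρ⁻¹ • (formVec θ z - v))).det := by
      conv_lhs => rw [← Matrix.updateRow_eq_self M e, hrow, Matrix.det_updateRow_add, hdet0,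
        Matrix.det_updateRow_smul, zero_add]
    rw [hdet, abs_mul, abs_of_pos hρ, Real.exp_add, Real.exp_log hρ, mul_comm]
    refine mul_le_mul_of_nonneg_right (hM _ (hlow _) fun j hj => ?_) hρ.le
    rcases eq_or_ne j e with rfl | hje
    · rw [Matrix.updateRow_self]
      refine ⟨by simp [h0], fun i => ?_⟩
      rw [Pi.smul_apply, Pi.sub_apply, smul_eq_mul, abs_mul, abs_of_pos (inv_pos.2 hρ),
        inv_mul_le_iff₀ hρ, mul_one]
      exact hle i
    · rw [Matrix.updateRow_ne hje]
      refine h2 j ?_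
      have : (j : ℕ) ≠ d := fun h => hje (Fin.ext h)
      omega

lemma exists_formVec_notMem {U : Submodule ℝ (Fin (n + 1) → ℝ)} (hU : U ≠ ⊤) :
    ∃ z : Fin (n + 1) → ℤ, formVec θ z ∉ U := by
  by_contra! hall
  refine hU (top_le_iff.1 ?_)
  have hdet : IsUnit (formMatrix θ).det := by rw [det_formMatrix]; exact isUnit_one
  have hli : LinearIndependent ℝ (formMatrix θ).row :=
    Matrix.linearIndependent_rows_iff_isUnit.2 ((Matrix.isUnit_iff_isUnit_det _).2 hdet)
  rw [← hli.span_eq_top_of_card_eq_finrank (by simp)]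
  refine Submodule.span_le.2 ?_
  rintro _ ⟨i, rfl⟩
  have : (formMatrix θ).row i = formVec θ (Pi.single i 1) := by
    rw [formVec_eq_vecMul]
    have : (fun j => ((Pi.single i 1 : Fin (n + 1) → ℤ) j : ℝ)) = Pi.single i 1 := by
      ext j; simp [Pi.single_apply]
    rw [this, Matrix.single_one_vecMul]
  rw [this]
  exact hall _

lemma exists_le_of_formHeightLE (U : Submodule ℝ (Fin (n + 1) → ℝ)) {y : Fin (n + 1) → ℝ}
    (hy : y ∈ U) (hy0 : y 0 ≠ 0) : ∃ K, ∀ a, FormHeightLE θ U a → K ≤ a := by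
  obtain ⟨m, hm⟩ : ∃ m, m = n + 1 - Module.finrank ℝ U := ⟨_, rfl⟩
  induction m generalizing U with
  | zero =>
    have htop : U = ⊤ := by
      refine Submodule.eq_top_of_finrank_eq (le_antisymm (Submodule.finrank_le _) ?_)
      rw [Module.finrank_fin_fun]
      omega
    subst htop
    exact ⟨0, fun a ha => ha.zero_le_of_top⟩
  | succ m ih =>
    have hne : U ≠ ⊤ := by
      rintro rfl
      simp at hm
    obtain ⟨z, hz⟩ := exists_formVec_notMem (θ := θ) hne
    have hfr := finrank_sup_span_singleton_of_notMem hz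
    obtain ⟨K, hK⟩ := ih (U ⊔ Submodule.span ℝ {formVec θ z})
      (Submodule.mem_sup_left hy) (by omega)
    set v : Fin (n + 1) → ℝ := (linVal θ z / y 0) • y with hv
    set ρ : ℝ := 1 + ∑ i, |formVec θ z i - v i| with hρdef
    have hρ : 0 < ρ := by positivity
    refine ⟨K - Real.log ρ, fun a ha => ?_⟩
    have := hK _ (ha.sup_span_singleton (U.smul_mem _ hy) hz (v := v)
      (by simp [hv, div_mul_cancel₀ _ hy0]) hρ fun i => by
        have := Finset.single_le_sum (f := fun i => |formVec θ z i - v i|)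
          (fun i _ => abs_nonneg _) (Finset.mem_univ i)
        linarith)
    linarith

lemma formHeightLE_span_singleton {z : Fin (n + 1) → ℤ} (hz : linVal θ z ≠ 0) :
    FormHeightLE θ (Submodule.span ℝ {formVec θ z}) (Real.log (n.factorial * |linVal θ z|)) := by
  have hne : formVec θ z ≠ 0 := fun h => hz (by rw [← formVec_zero, h]; rfl)
  rw [FormHeightLE, finrank_span_singleton hne]
  refine ⟨fun _ => z, ?_, fun M h1 h2 => ?_⟩
  · have : {j : Fin (n + 1) | (j : ℕ) < 1} = {0} := by
      ext j
      simp only [Set.mem_ofPred_eq, Set.mem_singleton_iff, Fin.ext_iff, Fin.val_zero]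
      omega
    rw [this, Set.image_singleton]
  · rw [Real.exp_log (by positivity), Matrix.det_succ_column_zero, Fin.sum_univ_succ,
      Finset.sum_eq_zero fun i _ => by rw [(h2 i.succ (by simp)).1]; ring]
    rw [h1 0 (by simp)]
    simp only [Fin.val_zero, pow_zero, formVec_zero, one_mul, add_zero, abs_mul]
    rw [mul_comm]
    refine mul_le_mul_of_nonneg_right ?_ (abs_nonneg _)
    have := Matrix.det_le (A := M.submatrix (Fin.succAbove 0) Fin.succ) (abv := AbsoluteValue.abs)
      (x := (1 : ℝ)) (fun i j => (h2 i.succ (by simp)).2 j.succ)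
    simpa using this

end FormHeight

/-- The sup norm of the coefficients `x₁, …, xₙ`. -/
def tailHeight {n : ℕ} (x : Fin (n + 1) → ℤ) : ℕ :=
  Finset.univ.sup fun i : Fin n => (x i.succ).natAbs

section MinimalPoints

variable {n : ℕ} {θ : Fin n → ℝ}

lemma abs_le_tailHeight (x : Fin (n + 1) → ℤ) (i : Fin n) :
    |(x i.succ : ℝ)| ≤ (tailHeight x : ℝ) := by
  have h : (x i.succ).natAbs ≤ tailHeight x :=
    Finset.le_sup (f := fun i : Fin n => (x i.succ).natAbs) (Finset.mem_univ i)
  calc |(x i.succ : ℝ)| = ((x i.succ).natAbs : ℝ) := by rw [Nat.cast_natAbs, Int.cast_abs]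
    _ ≤ _ := by exact_mod_cast h

lemma tailHeight_le {x : Fin (n + 1) → ℤ} {t : ℝ} (ht : 0 ≤ t)
    (h : ∀ i : Fin n, |(x i.succ : ℝ)| ≤ t) : (tailHeight x : ℝ) ≤ t := by
  have : tailHeight x ≤ ⌊t⌋₊ := Finset.sup_le fun i _ => Nat.le_floor (by
    rw [Nat.cast_natAbs, Int.cast_abs]; exact h i)
  exact (Nat.le_floor_iff ht).1 this

lemma one_le_tailHeight {x : Fin (n + 1) → ℤ} (h : ∃ i : Fin n, x i.succ ≠ 0) :
    1 ≤ tailHeight x := by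
  obtain ⟨i, hi⟩ := h
  have h1 : (x i.succ).natAbs ≤ tailHeight x :=
    Finset.le_sup (f := fun i : Fin n => (x i.succ).natAbs) (Finset.mem_univ i)
  have h2 := Int.natAbs_pos.2 hi
  omega

lemma finite_tailHeight_le (θ : Fin n → ℝ) (B : ℕ) (C : ℝ) :
    {x : Fin (n + 1) → ℤ | tailHeight x ≤ B ∧ |linVal θ x| ≤ C}.Finite := by
  obtain ⟨N, hN⟩ := exists_nat_ge (C + ∑ i, |θ i| * B)
  refine (Set.finite_Icc (fun _ => -((N + B : ℕ) : ℤ)) (fun _ => ((N + B : ℕ) : ℤ))).subset ?_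
  rintro x ⟨hx, hC⟩
  have hxB : ∀ i : Fin n, |(x i.succ : ℝ)| ≤ B := fun i =>
    (abs_le_tailHeight x i).trans (by exact_mod_cast hx)
  have key : ∀ j, |x j| ≤ ((N + B : ℕ) : ℤ) := by
    intro j
    have : |(x j : ℝ)| ≤ N + B := by
      refine Fin.cases ?_ (fun i => ?_) j
      · have h1 : (x 0 : ℝ) = linVal θ x - ∑ i, θ i * (x i.succ : ℝ) := by rw [linVal]; ring
        have h2 : |∑ i, θ i * (x i.succ : ℝ)| ≤ ∑ i, |θ i| * B :=
          (Finset.abs_sum_le_sum_abs _ _).trans (Finset.sum_le_sum fun i _ => by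
            rw [abs_mul]; exact mul_le_mul_of_nonneg_left (hxB i) (abs_nonneg _))
        have h3 := abs_sub (linVal θ x) (∑ i, θ i * (x i.succ : ℝ))
        rw [← h1] at h3
        have h4 : (0 : ℝ) ≤ B := Nat.cast_nonneg B
        linarith
      · have h4 : (0 : ℝ) ≤ N := Nat.cast_nonneg N
        linarith [hxB i]
    exact_mod_cast this
  exact ⟨fun j => (abs_le.1 (key j)).1, fun j => (abs_le.1 (key j)).2⟩

/-- Existence of a sequence of minimal points for the linear form. -/
lemma exists_minimalSeq
    (hne : ∀ x : Fin (n + 1) → ℤ, (∃ i : Fin n, x i.succ ≠ 0) → linVal θ x ≠ 0)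
    (hsmall : ∀ ε > 0, ∃ x : Fin (n + 1) → ℤ, (∃ i : Fin n, x i.succ ≠ 0) ∧ |linVal θ x| < ε) :
    ∃ p : ℕ → Fin (n + 1) → ℤ, (∀ k, ∃ i : Fin n, p k i.succ ≠ 0) ∧
      (∀ k, |linVal θ (p (k + 1))| < |linVal θ (p k)|) ∧
      (∀ k x, (∃ i : Fin n, x i.succ ≠ 0) → |linVal θ x| < |linVal θ (p k)| →
        tailHeight (p (k + 1)) ≤ tailHeight x) ∧
      (∀ k, tailHeight (p k) ≤ tailHeight (p (k + 1))) ∧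
      Filter.Tendsto (fun k => tailHeight (p k)) Filter.atTop Filter.atTop := by
  have hnext : ∀ z : {x : Fin (n + 1) → ℤ // ∃ i : Fin n, x i.succ ≠ 0},
      ∃ z' : {x : Fin (n + 1) → ℤ // ∃ i : Fin n, x i.succ ≠ 0},
        |linVal θ z'.1| < |linVal θ z.1| ∧ ∀ x : Fin (n + 1) → ℤ, (∃ i : Fin n, x i.succ ≠ 0) →
          |linVal θ x| < |linVal θ z.1| → tailHeight z'.1 ≤ tailHeight x := by
    intro z
    obtain ⟨x, hx, hlt⟩ := hsmall _ (abs_pos.2 (hne z.1 z.2))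
    let S : Set (Fin (n + 1) → ℤ) := {x | (∃ i : Fin n, x i.succ ≠ 0) ∧
      |linVal θ x| < |linVal θ z.1|}
    have hS : S.Nonempty := ⟨x, hx, hlt⟩
    have hmem := Function.argminOn_mem tailHeight S hS
    exact ⟨⟨_, hmem.1⟩, hmem.2, fun x hx hlt => Function.argminOn_le tailHeight S ⟨hx, hlt⟩⟩
  choose f hf1 hf2 using hnext
  obtain ⟨x₀, hx₀, -⟩ := hsmall 1 one_pos
  let P : ℕ → {x : Fin (n + 1) → ℤ // ∃ i : Fin n, x i.succ ≠ 0} := fun k => f^[k + 1] ⟨x₀, hx₀⟩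
  have hP : ∀ k, P (k + 1) = f (P k) := fun k => Function.iterate_succ_apply' f (k + 1) _
  have hdec : ∀ k, |linVal θ (P (k + 1)).1| < |linVal θ (P k).1| := fun k => by
    rw [hP]; exact hf1 _
  have hanti : StrictAnti fun k => |linVal θ (P k).1| := strictAnti_nat_of_succ_lt hdec
  have hmono : ∀ k, tailHeight (P k).1 ≤ tailHeight (P (k + 1)).1 := by
    intro k
    have hk : P k = f (f^[k] ⟨x₀, hx₀⟩) := Function.iterate_succ_apply' f k _
    rw [hk]
    refine hf2 _ _ (P (k + 1)).2 ?_
    refine (hdec k).trans ?_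
    rw [hk]
    exact hf1 _
  refine ⟨fun k => (P k).1, fun k => (P k).2, hdec, fun k => ?_, hmono, ?_⟩
  · simp only [hP]
    exact hf2 _
  refine Filter.tendsto_atTop_atTop_of_monotone (monotone_nat_of_le_succ hmono) fun B => ?_
  by_contra! hB
  have hinj : Function.Injective fun k => (P k).1 := fun a b hab =>
    hanti.injective (congrArg (fun x => |linVal θ x|) hab)
  refine Set.infinite_range_of_injective hinj
    ((finite_tailHeight_le θ B |linVal θ (P 0).1|).subset ?_)
  rintro _ ⟨k, rfl⟩
  exact ⟨(hB k).le, hanti.antitone (Nat.zero_le k)⟩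

lemma FormHeightLE.sup_formVec {U : Submodule ℝ (Fin (n + 1) → ℝ)} {a ρ : ℝ}
    {q z : Fin (n + 1) → ℤ} (h : FormHeightLE θ U a) (hq : formVec θ q ∈ U)
    (hz : formVec θ z ∉ U) (hq0 : linVal θ q ≠ 0) (hρ : 0 < ρ)
    (hle : tailHeight z + |linVal θ z| / |linVal θ q| * tailHeight q ≤ ρ) :
    FormHeightLE θ (U ⊔ Submodule.span ℝ {formVec θ z}) (a + Real.log ρ) := by
  refine h.sup_span_singleton (U.smul_mem (linVal θ z / linVal θ q) hq) hz ?_ hρ fun i => ?_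
  · simp [div_mul_cancel₀ _ hq0]
  · refine Fin.cases ?_ (fun i => ?_) i
    · simp [div_mul_cancel₀ _ hq0, hρ.le]
    · refine le_trans ?_ hle
      rw [Pi.smul_apply, formVec_succ, formVec_succ, smul_eq_mul]
      refine (abs_sub _ _).trans (add_le_add (abs_le_tailHeight z i) ?_)
      rw [abs_mul, abs_div]
      exact mul_le_mul_of_nonneg_left (abs_le_tailHeight q i) (by positivity)

/-- If the linear form system is solvable with exponent `w' > w` for all large `t`, and with
exponent `W ≥ w` for no large `t`, then `w ≤ 1 + W / w + ⋯ + (W / w) ^ (n - 1)`. -/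
theorem le_geom_sum_of_solvable
    (hne : ∀ x : Fin (n + 1) → ℤ, (∃ i : Fin n, x i.succ ≠ 0) → linVal θ x ≠ 0)
    {w w' W T T' : ℝ} (hw : 0 < w) (hww : w < w') (hwW : w ≤ W)
    (hT : ∀ t, T < t → LinSolvable n θ w' t) (hT' : ∀ t, T' < t → ¬ LinSolvable n θ W t) :
    w ≤ ∑ j ∈ Finset.range n, (W / w) ^ j := by
  have hsmall : ∀ ε > 0, ∃ x : Fin (n + 1) → ℤ,
      (∃ i : Fin n, x i.succ ≠ 0) ∧ |linVal θ x| < ε := by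
    intro ε hε
    obtain ⟨t, htT, ht⟩ := ((Filter.eventually_gt_atTop T).and
      ((tendsto_rpow_neg_atTop (hw.trans hww)).eventually_lt_const hε)).exists
    obtain ⟨x, hx, -, hL⟩ := hT t htT
    exact ⟨x, hx, hL.trans_lt ht⟩
  obtain ⟨p, hp, hdec, hmin, hmono, htend⟩ := exists_minimalSeq hne hsmall
  have hL : ∀ k, 0 < |linVal θ (p k)| := fun k => abs_pos.2 (hne _ (hp k))
  have hX : ∀ k, (1 : ℝ) ≤ tailHeight (p k) := fun k => by
    exact_mod_cast one_le_tailHeight (hp k)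
  have hX0 : ∀ k, (0 : ℝ) < tailHeight (p k) := fun k => one_pos.trans_le (hX k)
  have hXm : ∀ k, (tailHeight (p k) : ℝ) ≤ tailHeight (p (k + 1)) := fun k => by
    exact_mod_cast hmono k
  have htendR : Filter.Tendsto (fun k => (tailHeight (p k) : ℝ)) Filter.atTop Filter.atTop :=
    tendsto_natCast_atTop_atTop.comp htend
  have htendL := Real.tendsto_log_atTop.comp htendR
  obtain ⟨N, hN⟩ := Filter.eventually_atTop.1
    ((htendR.eventually_gt_atTop (2 * T)).and ((htendR.eventually_gt_atTop T').and
    (htendL.eventually_ge_atTop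
      ((w * Real.log 2 + w' * Real.log 2 + Real.log n.factorial) / (w' - w)))))
  have hfac : (1 : ℝ) ≤ n.factorial := by exact_mod_cast n.factorial_pos
  have hfac0 : (n.factorial : ℝ) ≠ 0 := by positivity
  have hlogfac := Real.log_nonneg hfac
  have hlog2 : 0 < Real.log 2 := Real.log_pos one_lt_two
  have hsys : HeightSystem (fun i => formVec θ (p (i + N)))
      (fun i => Real.log (2 * tailHeight (p (i + N))))
      (fun i => - Real.log (n.factorial * |linVal θ (p (i + N))|)) (FormHeightLE θ) w (W / w) := by
    have hx_eq : ∀ k, Real.log (2 * tailHeight (p k)) = Real.log 2 + Real.log (tailHeight (p k)) :=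
      fun k => Real.log_mul two_ne_zero (hX0 k).ne'
    have hl_eq : ∀ k, Real.log (n.factorial * |linVal θ (p k)|) =
        Real.log n.factorial + Real.log |linVal θ (p k)| :=
      fun k => Real.log_mul hfac0 (hL k).ne'
    refine ⟨hw, (one_le_div hw).2 hwW, fun U a b h hab => h.mono hab, fun i => ?_, ?_, ?_, ?_,
      fun i => ?_, fun i => ?_, fun i => ?_, ?_, fun i h => ?_, fun i h => ?_⟩
    · rw [neg_neg]
      exact formHeightLE_span_singleton (hne _ (hp _))
    · intro U b a hy hz ha
      have e : b + 1 + N = b + N + 1 := by omega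
      simp only [e] at hz ⊢
      refine ha.sup_formVec hy hz (hne _ (hp _)) (by linarith [hX0 (b + N + 1)]) ?_
      have h1 : |linVal θ (p (b + N + 1))| / |linVal θ (p (b + N))| ≤ 1 :=
        (div_le_one (hL _)).2 (hdec _).le
      have h2 := mul_le_mul h1 (hXm (b + N)) (hX0 _).le zero_le_one
      linarith
    · intro U i a hy hz ha
      have e : i + 1 + N = i + N + 1 := by omega
      simp only [e] at hy ⊢
      set k := i + N
      have hρ : 0 < 2 * tailHeight (p (k + 1)) * (|linVal θ (p k)| / |linVal θ (p (k + 1))|) :=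
        mul_pos (by linarith [hX0 (k + 1)]) (div_pos (hL _) (hL _))
      refine (ha.sup_formVec hy hz (hne _ (hp _)) hρ ?_).mono (le_of_eq ?_)
      · have h1 : 1 ≤ |linVal θ (p k)| / |linVal θ (p (k + 1))| :=
          (one_le_div (hL _)).2 (hdec _).le
        have h2 := mul_le_mul h1 (hXm k) (hX0 _).le (zero_le_one.trans h1)
        linarith
      · rw [Real.log_mul (by linarith [hX0 (k + 1)]) (div_pos (hL _) (hL _)).ne',
          Real.log_div (hL _).ne' (hL _).ne', hl_eq, hl_eq]
        ring
    · intro U i hi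
      exact exists_le_of_formHeightLE U hi (hne _ (hp _))
    · have e : i + 1 + N = i + N + 1 := by omega
      simp only [e]
      set k := i + N
      obtain ⟨h1, -, h3⟩ := hN (k + 1) (by omega)
      have hh : (0 : ℝ) < tailHeight (p (k + 1)) / 2 := half_pos (hX0 _)
      obtain ⟨x, hx, hxt, hxL⟩ := hT (tailHeight (p (k + 1)) / 2) (by linarith)
      have hle : |linVal θ (p k)| ≤ ((tailHeight (p (k + 1)) : ℝ) / 2) ^ (-w') := by
        refine le_trans ?_ hxL
        by_contra! hlt
        have h4 : (tailHeight (p (k + 1)) : ℝ) ≤ tailHeight x := by exact_mod_cast hmin k x hx hlt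
        have h5 := tailHeight_le hh.le hxt
        linarith
      have hlog := Real.log_le_log (hL k) hle
      rw [Real.log_rpow hh, Real.log_div (hX0 _).ne' two_ne_zero] at hlog
      rw [Function.comp_apply, div_le_iff₀ (by linarith)] at h3
      rw [hx_eq, hl_eq]
      linarith
    · set k := i + N
      obtain ⟨-, h2, -⟩ := hN k (by omega)
      have hlt : (tailHeight (p k) : ℝ) ^ (-W) < |linVal θ (p k)| := by
        by_contra! hle
        exact hT' _ h2 ⟨p k, hp k, abs_le_tailHeight _, hle⟩
      have hlog := Real.log_lt_log (Real.rpow_pos_of_pos (hX0 _) _) hlt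
      rw [Real.log_rpow (hX0 _)] at hlog
      rw [div_mul_cancel₀ _ hw.ne', hx_eq, hl_eq]
      have := mul_pos (hw.trans_le hwW) hlog2
      linarith
    · exact Real.log_pos (by linarith [hX (i + N)])
    · exact Real.tendsto_log_atTop.comp
        (((Filter.tendsto_add_atTop_iff_nat N).2 htendR).const_mul_atTop two_pos)
    · exact hne _ (hp (i + N)) (congrFun h 0)
    · have e : i + 1 + N = i + N + 1 := by omega
      simp only [e] at h
      set k := i + N
      obtain ⟨c, hc⟩ := Submodule.mem_span_singleton.1 h
      have hc0 : c * linVal θ (p k) = linVal θ (p (k + 1)) := congrFun hc 0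
      have hc1 : |c| < 1 := by
        have h1 := hdec k
        rw [← hc0, abs_mul] at h1
        by_contra! hcon
        nlinarith [hL k]
      have h2 : (tailHeight (p (k + 1)) : ℝ) ≤ |c| * tailHeight (p k) := by
        refine tailHeight_le (by positivity) fun j => ?_
        have : c * (p k j.succ : ℝ) = (p (k + 1) j.succ : ℝ) := congrFun hc j.succ
        rw [← this, abs_mul]
        exact mul_le_mul_of_nonneg_left (abs_le_tailHeight _ _) (abs_nonneg _)
      nlinarith [hX0 k, hXm k]
  exact hsys.le_geom_sum (by simp)

end MinimalPoints

section Exponents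

variable {n : ℕ} {θ : Fin n → ℝ}

lemma linVal_ne_zero (hindep : LinearIndependent ℚ (Fin.cons 1 θ : Fin (n + 1) → ℝ))
    (x : Fin (n + 1) → ℤ) (hx : ∃ i : Fin (n + 1), x i ≠ 0) : linVal θ x ≠ 0 := by
  intro h
  obtain ⟨i, hi⟩ := hx
  have := Fintype.linearIndependent_iff.1 hindep (fun i => (x i : ℚ)) (by
    rw [Fin.sum_univ_succ]
    simp only [Fin.cons_zero, Fin.cons_succ, Rat.smul_def, Rat.cast_intCast, mul_one]
    rw [← h, linVal]
    simp only [mul_comm]) i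
  exact hi (by exact_mod_cast this)

lemma linSolvable_one (hn : 0 < n) {t : ℝ} (ht : 1 ≤ t) : LinSolvable n θ 1 t := by
  have hfl : 0 < ⌊t⌋₊ := Nat.floor_pos.2 ht
  obtain ⟨j, k, hk0, hk, hjk⟩ := Real.exists_int_int_abs_mul_sub_le (θ ⟨0, hn⟩) hfl
  refine ⟨Fin.cons (-j) (Pi.single ⟨0, hn⟩ k), ⟨⟨0, hn⟩, ?_⟩, fun i => ?_, ?_⟩
  · rw [Fin.cons_succ, Pi.single_eq_same]
    exact hk0.ne'
  · have hkt : (k : ℝ) ≤ t := by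
      have h1 : (k : ℝ) ≤ (⌊t⌋₊ : ℝ) := by exact_mod_cast hk
      exact h1.trans (Nat.floor_le (by linarith))
    have hk0' : (0 : ℝ) < k := by exact_mod_cast hk0
    rw [Fin.cons_succ, Pi.single_apply]
    split_ifs
    · rwa [abs_of_pos hk0']
    · simp; linarith
  · have hsum : ∑ i : Fin n, θ i * (((Pi.single ⟨0, hn⟩ k : Fin n → ℤ) i : ℤ) : ℝ) =
        k * θ ⟨0, hn⟩ := by
      rw [Finset.sum_eq_single ⟨0, hn⟩]
      · simp [mul_comm]
      · intro i _ hi; simp [hi]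
      · simp
    simp only [Fin.cons_zero, Fin.cons_succ, hsum]
    rw [Real.rpow_neg_one]
    push_cast
    rw [neg_add_eq_sub]
    refine hjk.trans ?_
    rw [one_div]
    exact inv_anti₀ (by linarith) (Nat.lt_floor_add_one t).le

/-- Solutions of the simultaneous system have unbounded denominators. -/
lemma eventually_lt_abs_of_simSolvable (hn : 0 < n)
    (hirr : ∀ a b : ℤ, a ≠ 0 → (a : ℝ) * θ ⟨0, hn⟩ - b ≠ 0) {γ : ℝ} (hγ : 0 < γ) (B : ℕ) :
    ∀ᶠ t in Filter.atTop, ∀ x : Fin (n + 1) → ℤ, x 0 ≠ 0 →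
      (∀ i : Fin n, |(x 0 : ℝ) * θ i - (x i.succ : ℝ)| ≤ t ^ (-γ)) → (B : ℝ) < |(x 0 : ℝ)| := by
  have h : ∀ a ∈ (Finset.Icc (-(B : ℤ)) B), ∀ᶠ t : ℝ in Filter.atTop, a ≠ 0 →
      t ^ (-γ) < |(a : ℝ) * θ ⟨0, hn⟩ - round ((a : ℝ) * θ ⟨0, hn⟩)| := by
    intro a _
    by_cases ha : a = 0
    · simp [ha]
    · filter_upwards [(tendsto_rpow_neg_atTop hγ).eventually_lt_const
        (abs_pos.2 (hirr a (round ((a : ℝ) * θ ⟨0, hn⟩)) ha))] with t ht _ using ht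
  filter_upwards [(Filter.eventually_all_finset _).2 h] with t ht x hx0 hx
  by_contra! hB
  have hB' : |x 0| ≤ (B : ℤ) := by exact_mod_cast hB
  have h1 := ht (x 0) (Finset.mem_Icc.2 (abs_le.1 hB')) hx0
  have h2 := round_le ((x 0 : ℝ) * θ ⟨0, hn⟩) (x (Fin.succ ⟨0, hn⟩))
  exact absurd (hx ⟨0, hn⟩) (not_le.2 (h1.trans_le h2))

/-- A good simultaneous approximation `x` forces the integer points provided by the uniform
exponent into the orthogonal complement of `x`, where the linear form is very small. -/
lemma exists_linSolvable_of_simSolvable (hn : 0 < n)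
    (hirr : ∀ a b : ℤ, a ≠ 0 → (a : ℝ) * θ ⟨0, hn⟩ - b ≠ 0) {γ w w' W T : ℝ} (hγ : 0 < γ)
    (hw : 0 < w) (hww : w < w') (hT : ∀ t, T < t → LinSolvable n θ w' t)
    (hS : ∀ T, ∃ t, T < t ∧ SimSolvable n θ γ t) (h1 : 1 < γ * w) (h2 : W + 1 < (1 + γ) * w)
    (T' : ℝ) : ∃ t, T' < t ∧ LinSolvable n θ W t := by
  have hn0 : (0 : ℝ) < n := by exact_mod_cast hn
  have e1 : 0 < w' / w - 1 := sub_pos.2 ((one_lt_div hw).2 hww)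
  have e2 : 0 < γ - 1 / w := sub_pos.2 ((div_lt_iff₀ hw).2 h1)
  have e3 : 0 < (1 + γ) - (W + 1) / w := sub_pos.2 ((div_lt_iff₀ hw).2 h2)
  have t0 := tendsto_rpow_atTop (one_div_pos.2 hw)
  have hev := ((t0.eventually_gt_atTop T).and (t0.eventually_gt_atTop T')).and
    (((tendsto_rpow_neg_atTop e1).eventually_lt_const (show (0 : ℝ) < 1 / 2 by norm_num)).and
    (((tendsto_rpow_neg_atTop e2).eventually_lt_const
      (show (0 : ℝ) < 1 / (2 * n) by positivity)).and
    ((tendsto_rpow_neg_atTop e3).eventually_lt_const (show (0 : ℝ) < 1 / n by positivity))))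
  obtain ⟨Q, hQ⟩ := Filter.eventually_atTop.1 hev
  obtain ⟨B, hB⟩ := exists_nat_ge Q
  obtain ⟨T₁, hT₁⟩ := Filter.eventually_atTop.1 (eventually_lt_abs_of_simSolvable hn hirr hγ B)
  obtain ⟨t₁, ht₁, x, hx0, hxt, hx⟩ := hS T₁
  have hBq := hT₁ t₁ ht₁.le x hx0 hx
  set q : ℝ := |(x 0 : ℝ)| with hq
  have hq0 : 0 < q := lt_of_le_of_lt (Nat.cast_nonneg B) hBq
  obtain ⟨⟨hqT, hqT'⟩, a1, a2, a3⟩ := hQ q (hB.trans hBq.le)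
  obtain ⟨y, hy, hyt, hyL⟩ := hT _ hqT
  change |linVal θ y| ≤ _ at hyL
  rw [← Real.rpow_mul hq0.le] at hyL
  set S : ℝ := ∑ i : Fin n, ((x 0 : ℝ) * θ i - x i.succ) * y i.succ with hS'
  have hSle : |S| ≤ n * q ^ (-(γ - 1 / w)) := by
    calc |S| ≤ ∑ i : Fin n, |((x 0 : ℝ) * θ i - x i.succ) * y i.succ| :=
          Finset.abs_sum_le_sum_abs _ _
      _ ≤ ∑ _i : Fin n, q ^ (-(γ - 1 / w)) := by
          refine Finset.sum_le_sum fun i _ => ?_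
          have hexp : -(γ - 1 / w) = -γ + 1 / w := by ring
          rw [abs_mul, hexp, Real.rpow_add hq0]
          refine mul_le_mul ((hx i).trans ?_) (hyt i) (abs_nonneg _) (by positivity)
          exact Real.rpow_le_rpow_of_nonpos hq0 hxt (by linarith)
      _ = _ := by simp
  have hm : (x 0 : ℝ) * linVal θ y - S =
      ((x 0 * y 0 + ∑ i : Fin n, x i.succ * y i.succ : ℤ) : ℝ) := by
    push_cast
    rw [linVal, hS', mul_add, Finset.mul_sum, add_sub_assoc, ← Finset.sum_sub_distrib]
    congr 1
    exact Finset.sum_congr rfl fun i _ => by ring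
  have hqL : |(x 0 : ℝ) * linVal θ y| < 1 / 2 := by
    rw [abs_mul]
    refine lt_of_le_of_lt (mul_le_mul_of_nonneg_left hyL (abs_nonneg _)) (lt_of_le_of_lt ?_ a1)
    have : -(w' / w - 1) = 1 + 1 / w * -w' := by ring
    rw [this, Real.rpow_add hq0, Real.rpow_one]
  have hS2 : |S| < 1 / 2 := by
    refine hSle.trans_lt ?_
    rw [lt_div_iff₀ (by positivity)] at a2
    linarith
  have hzero : x 0 * y 0 + ∑ i : Fin n, x i.succ * y i.succ = 0 := by
    rw [← Int.abs_lt_one_iff]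
    have := abs_sub ((x 0 : ℝ) * linVal θ y) S
    rw [hm] at this
    have h3 : |((x 0 * y 0 + ∑ i : Fin n, x i.succ * y i.succ : ℤ) : ℝ)| < 1 := by linarith
    exact_mod_cast h3
  rw [hzero, Int.cast_zero, sub_eq_zero] at hm
  refine ⟨q ^ (1 / w), hqT', y, hy, hyt, ?_⟩
  change |linVal θ y| ≤ _
  rw [← Real.rpow_mul hq0.le]
  have h4 : q * |linVal θ y| ≤ n * q ^ (-(γ - 1 / w)) := by
    rw [hq, ← abs_mul, hm]; exact hSle
  have h5 : q ^ (-(γ - 1 / w)) = q * q ^ (1 / w * -W) * q ^ (-((1 + γ) - (W + 1) / w)) := by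
    have hexp : -(γ - 1 / w) = 1 + 1 / w * -W + -((1 + γ) - (W + 1) / w) := by field_simp; ring
    rw [hexp, Real.rpow_add hq0, Real.rpow_add hq0, Real.rpow_one]
  rw [lt_div_iff₀ hn0] at a3
  have h6 : 0 < q * q ^ (1 / w * -W) := by positivity
  have h7 : q * |linVal θ y| ≤ q * q ^ (1 / w * -W) := by
    rw [h5] at h4
    nlinarith
  exact le_of_mul_le_mul_left h7 hq0

lemma Glin_le {b R : ℝ} (hn : 2 ≤ n) (hb : 0 < b) (hR : 1 ≤ R)
    (h : b ≤ ∑ j ∈ Finset.range n, R ^ j) : Glin n b ≤ R := by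
  refine csSup_le ⟨1, by simp⟩ fun x hx => ?_
  by_contra! hlt
  have hx' : b⁻¹ * x ^ n - x + (1 - b⁻¹) = 0 := hx
  have h1 : x ^ n - 1 = b * (x - 1) := by
    field_simp at hx'
    linarith
  rw [← geom_sum_mul] at h1
  have h2 : ∑ j ∈ Finset.range n, x ^ j = b :=
    mul_right_cancel₀ (sub_ne_zero.2 (hR.trans_lt hlt).ne') h1
  have h3 : ∑ j ∈ Finset.range n, R ^ j < ∑ j ∈ Finset.range n, x ^ j :=
    Finset.sum_lt_sum (fun j _ => pow_le_pow_left₀ (by linarith) hlt.le j)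
      ⟨1, Finset.mem_range.2 (by omega), by simpa using hlt⟩
  linarith

lemma omegaHatExp_le_omegaExp (θ : Fin n → ℝ) : omegaHatExp n θ ≤ omegaExp n θ := by
  refine sSup_le_sSup ?_
  rintro e ⟨γ, hγ, rfl, T, hT⟩
  exact ⟨γ, hγ, rfl, fun T' => ⟨max T T' + 1, by linarith [le_max_right T T'],
    hT _ (by linarith [le_max_left T T'])⟩⟩

lemma one_le_omegaHatExp (hn : 0 < n) : 1 ≤ omegaHatExp n θ :=
  le_sSup ⟨1, one_pos, by simp, 1, fun _ ht => linSolvable_one hn ht.le⟩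

lemma exists_forall_linSolvable {w : ℝ} (h : ENNReal.ofReal w < omegaHatExp n θ) :
    ∃ w' T, w < w' ∧ ∀ t, T < t → LinSolvable n θ w' t := by
  obtain ⟨_, ⟨γ, hγ, rfl, T, hT⟩, hlt⟩ := lt_sSup_iff.1 h
  exact ⟨γ, T, (ENNReal.ofReal_lt_ofReal_iff hγ).1 hlt, hT⟩

lemma exists_forall_not_linSolvable {W : ℝ} (hW : 0 < W) (h : omegaExp n θ < ENNReal.ofReal W) :
    ∃ T, ∀ t, T < t → ¬ LinSolvable n θ W t := by
  by_contra! hcon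
  have hle : ENNReal.ofReal W ≤ omegaExp n θ := le_sSup ⟨W, hW, rfl, hcon⟩
  exact absurd hle (not_le.2 h)

end Exponents

/-- if `1, θ₁, …, θₙ` are linearly independent over `ℚ` and `ω < ∞`, then
`ω/ω̂ ≥ max(B(ω,λ), G_lin(ω̂))`, where `B(ω,λ) = (1+λ)/(1+ω⁻¹)`. -/
theorem stmt10 (n : ℕ) (hn : 2 ≤ n) (θ : Fin n → ℝ)
    (hindep : LinearIndependent ℚ (Fin.cons 1 θ : Fin (n+1) → ℝ))
    (hω : omegaExp n θ < ⊤) :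
    omegaExp n θ / omegaHatExp n θ ≥
      max ((1 + lambdaExp n θ) / (1 + (omegaExp n θ)⁻¹))
        (ENNReal.ofReal (Glin n (omegaHatExp n θ).toReal)) := by
  have hn0 : 0 < n := by omega
  have hirr : ∀ a b : ℤ, a ≠ 0 → (a : ℝ) * θ ⟨0, hn0⟩ - b ≠ 0 := by
    intro a b ha h
    refine linVal_ne_zero hindep (Fin.cons (-b) (Pi.single ⟨0, hn0⟩ a))
      ⟨Fin.succ ⟨0, hn0⟩, by rw [Fin.cons_succ, Pi.single_eq_same]; exact ha⟩ ?_
    rw [linVal, Finset.sum_eq_single ⟨0, hn0⟩]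
    · simp only [Fin.cons_zero, Fin.cons_succ, Pi.single_eq_same]
      push_cast
      linarith
    · intro i _ hi; simp [hi]
    · simp
  have hle := omegaHatExp_le_omegaExp θ
  have hone : 1 ≤ omegaHatExp n θ := one_le_omegaHatExp hn0
  obtain ⟨a, ha⟩ : ∃ a, a = (omegaExp n θ).toReal := ⟨_, rfl⟩
  obtain ⟨b, hb⟩ : ∃ b, b = (omegaHatExp n θ).toReal := ⟨_, rfl⟩
  have hωa : omegaExp n θ = ENNReal.ofReal a := by rw [ha, ENNReal.ofReal_toReal hω.ne]
  have hωb : omegaHatExp n θ = ENNReal.ofReal b := by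
    rw [hb, ENNReal.ofReal_toReal (hle.trans_lt hω).ne]
  have hb1 : 1 ≤ b := by rwa [hωb, ENNReal.one_le_ofReal] at hone
  have hb0 : 0 < b := by linarith
  have hab : b ≤ a := by
    rw [hωa, hωb] at hle
    rcases ENNReal.ofReal_le_ofReal_iff'.1 hle with h | h <;> linarith
  have ha0 : 0 < a := by linarith
  have hlow : ∀ w, w < b → ∃ w' T, w < w' ∧ ∀ t, T < t → LinSolvable n θ w' t := fun w hw =>
    exists_forall_linSolvable (by rw [hωb]; exact (ENNReal.ofReal_lt_ofReal_iff hb0).2 hw)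
  have hupp : ∀ W, a < W → ∃ T, ∀ t, T < t → ¬ LinSolvable n θ W t := fun W hW =>
    exists_forall_not_linSolvable (ha0.trans hW)
      (by rw [hωa]; exact (ENNReal.ofReal_lt_ofReal_iff (ha0.trans hW)).2 hW)
  have hgeom : b ≤ ∑ j ∈ Finset.range n, (a / b) ^ j := by
    have hcont : Filter.Tendsto
        (fun δ : ℝ => ∑ j ∈ Finset.range n, ((a + δ) / (b - δ)) ^ j - (b - δ))
        (nhdsWithin 0 (Set.Ioi 0))
        (nhds (∑ j ∈ Finset.range n, ((a + 0) / (b - 0)) ^ j - (b - 0))) := by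
      refine Filter.Tendsto.mono_left (ContinuousAt.tendsto ?_) nhdsWithin_le_nhds
      have : b - 0 ≠ 0 := by linarith
      fun_prop (disch := assumption)
    have hnonneg : ∀ᶠ δ : ℝ in nhdsWithin 0 (Set.Ioi 0),
        0 ≤ ∑ j ∈ Finset.range n, ((a + δ) / (b - δ)) ^ j - (b - δ) := by
      filter_upwards [Ioo_mem_nhdsGT hb0] with δ hδ
      obtain ⟨w', T, hw', hT⟩ := hlow (b - δ) (by linarith [hδ.1])
      obtain ⟨T', hT'⟩ := hupp (a + δ) (by linarith [hδ.1])
      exact sub_nonneg.2 (le_geom_sum_of_solvable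
        (fun x ⟨i, hi⟩ => linVal_ne_zero hindep x ⟨i.succ, hi⟩)
        (by linarith [hδ.2]) hw' (by linarith [hδ.1]) hT hT')
    have := ge_of_tendsto hcont hnonneg
    simp only [add_zero, sub_zero] at this
    linarith
  have hlam : lambdaExp n θ ≤ ENNReal.ofReal ((a + 1) / b - 1) := by
    refine sSup_le ?_
    rintro _ ⟨γ, hγ, rfl, hS⟩
    refine ENNReal.ofReal_le_ofReal ?_
    by_contra! hcon
    have h1 : a + 1 < (1 + γ) * b := by
      rw [sub_lt_iff_lt_add', div_lt_iff₀ hb0] at hcon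
      exact hcon
    obtain ⟨W, hW1, hW2⟩ := exists_between (show a < (1 + γ) * b - 1 by linarith)
    obtain ⟨w, hw1, hw2⟩ := exists_between
      (show (W + 1) / (1 + γ) < b by rw [div_lt_iff₀ (by linarith)]; linarith)
    have hw : W + 1 < (1 + γ) * w := by
      rw [div_lt_iff₀ (by linarith)] at hw1
      linarith
    have hw0 : 0 < w := lt_trans (div_pos (by linarith) (by linarith)) hw1
    obtain ⟨w', T, hw', hT⟩ := hlow w hw2
    obtain ⟨T', hT'⟩ := hupp W hW1
    obtain ⟨t, ht, hsol⟩ := exists_linSolvable_of_simSolvable hn0 hirr hγ hw0 hw' hT hS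
      (by linarith) hw T'
    exact hT' t ht hsol
  have hdiv : omegaExp n θ / omegaHatExp n θ = ENNReal.ofReal (a / b) := by
    rw [hωa, hωb, ENNReal.ofReal_div_of_pos hb0]
  rw [hdiv, ge_iff_le, ← hb]
  refine max_le (ENNReal.div_le_of_le_mul ?_)
    (ENNReal.ofReal_le_ofReal (Glin_le hn hb0 ((one_le_div hb0).2 hab) hgeom))
  have hc : 0 ≤ (a + 1) / b - 1 := sub_nonneg.2 ((one_le_div hb0).2 (by linarith))
  calc 1 + lambdaExp n θ ≤ ENNReal.ofReal 1 + ENNReal.ofReal ((a + 1) / b - 1) := by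
        rw [ENNReal.ofReal_one]; gcongr
    _ = ENNReal.ofReal (a / b) * (1 + (omegaExp n θ)⁻¹) := by
        rw [hωa, ← ENNReal.ofReal_inv_of_pos ha0, ← ENNReal.ofReal_one,
          ← ENNReal.ofReal_add zero_le_one hc, ← ENNReal.ofReal_add zero_le_one (by positivity),
          ← ENNReal.ofReal_mul (by positivity)]
        congr 1
        field_simp
        ring
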